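/- Let (R,m,k) be a commutative Noetherian local ring, let X be a finitely generated R-module and let N be a Burch submodule of X. If M is a finitely generated R-module and t ≥ 1 is an integer such that Tor_t^R(M, X/N) = 0 and Tor_{t+1}^R(M, X/N) = 0, then the projective dimension of M is strictly less than t. -/

import Mathlib

open CategoryTheory

universe u

/-- The colon submodule `(N :_X I) = {x ∈ X : I • x ⊆ N}`. -/
def Submodule.colonBy {R X : Type u} [CommRing R] [AddCommGroup X] [Module R X]
    (N : Submodule R X) (I : Ideal R) : Submodule R X where
  carrier := {x | ∀ r ∈ I, r • x ∈ N}
  add_mem' := by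
    intro a b ha hb r hr
    rw [smul_add]
    exact N.add_mem (ha r hr) (hb r hr)
  zero_mem' := by
    intro r hr
    rw [smul_zero]
    exact N.zero_mem
  smul_mem' := by
    intro c x hx r hr
    rw [smul_comm]
    exact N.smul_mem c (hx r hr)

/-- A submodule `N` of a module `X` over a local ring `(R, 𝔪)` is *Burch* if
`𝔪 • (N :_X 𝔪) ≠ 𝔪 • N`. -/
def Submodule.IsBurch {R X : Type u} [CommRing R] [IsLocalRing R] [AddCommGroup X]
    [Module R X] (N : Submodule R X) : Prop :=
  IsLocalRing.maximalIdeal R • N.colonBy (IsLocalRing.maximalIdeal R) ≠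
    IsLocalRing.maximalIdeal R • N

/-- `Tor_n^R(M, N) = 0`. -/
def TorIsZero (R : Type u) [CommRing R] (M N : Type u) [AddCommGroup M] [Module R M]
    [AddCommGroup N] [Module R N] (n : ℕ) : Prop :=
  Subsingleton (((Tor (ModuleCat.{u} R) n).obj (ModuleCat.of R M)).obj (ModuleCat.of R N))

/-- `Ext^n_R(M, N) = 0`. -/
def ExtIsZero (R : Type u) [CommRing R] (M N : Type u) [AddCommGroup M] [Module R M]
    [AddCommGroup N] [Module R N] (n : ℕ) : Prop :=
  Subsingleton
    (((Ext R (ModuleCat.{u} R) n).obj (Opposite.op (ModuleCat.of R M))).obj (ModuleCat.of R N))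

/-- `M` has projective dimension strictly less than `t`, i.e. `M` admits a projective
resolution vanishing in all degrees `≥ t`. -/
def HasProjDimLT (R : Type u) [CommRing R] (M : Type u) [AddCommGroup M] [Module R M]
    (t : ℕ) : Prop :=
  ∃ P : ProjectiveResolution (ModuleCat.of R M), ∀ i, t ≤ i → Limits.IsZero (P.complex.X i)

/-- `M` has injective dimension strictly less than `t`, i.e. `M` admits an injective
resolution vanishing in all degrees `≥ t`. -/
def HasInjDimLT (R : Type u) [CommRing R] (M : Type u) [AddCommGroup M] [Module R M]
    (t : ℕ) : Prop :=
  ∃ I : InjectiveResolution (ModuleCat.of R M), ∀ i, t ≤ i → Limits.IsZero (I.cocomplex.X i)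

/-- The depth of a module `M` over a local ring `(R, 𝔪, k)`: the smallest `i` such that
`Ext^i_R(k, M) ≠ 0` (and `⊤` if no such `i` exists). -/
noncomputable def moduleDepth (R : Type u) [CommRing R] [IsLocalRing R] (M : Type u)
    [AddCommGroup M] [Module R M] : ℕ∞ :=
  sInf {n : ℕ∞ | ∃ i : ℕ, n = (i : ℕ∞) ∧ ¬ ExtIsZero R (IsLocalRing.ResidueField R) M i}

open IsLocalRing TensorProduct

/-- A finitely generated module over a local ring has a minimal finite free cover. -/
theorem IsLocalRing.exists_minimal_free_cover (R : Type*) [CommRing R] [IsLocalRing R]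
    (M : Type*) [AddCommGroup M] [Module R M] [Module.Finite R M] :
    ∃ (n : ℕ) (f : (Fin n → R) →ₗ[R] M), Function.Surjective f ∧
      ∀ c, f c = 0 → ∀ i, c i ∈ maximalIdeal R := by
  let b := Module.finBasis (ResidueField R) (ResidueField R ⊗[R] M)
  obtain ⟨v, hv⟩ := (TensorProduct.mk_surjective R M (ResidueField R)
    Ideal.Quotient.mk_surjective).comp_left b
  refine ⟨_, Fintype.linearCombination R v, ?_, fun c hc i ↦ ?_⟩
  · rw [← LinearMap.range_eq_top, Fintype.range_linearCombination]
    exact span_eq_top_of_tmul_eq_basis v b (congr_fun hv)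
  · have h : ∑ j, residue R (c j) • b j = 0 := by
      have h' := congrArg (TensorProduct.mk R (ResidueField R) M 1) hc
      rw [Fintype.linearCombination_apply, map_sum, map_zero] at h'
      rw [← h']
      refine Finset.sum_congr rfl fun j _ ↦ ?_
      rw [map_smul, ← congr_fun hv j]
      exact IsScalarTower.algebraMap_smul _ _ _
    exact (residue_eq_zero_iff _).1 (Fintype.linearIndependent_iff.1 b.linearIndependent _ h i)

/-- A Burch submodule `N` has `a ∈ 𝔪` and `x ∈ (N : 𝔪)` with `a • x ∉ 𝔪 • N`. -/
theorem Submodule.IsBurch.exists_smul_notMem {R X : Type u} [CommRing R] [IsLocalRing R]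
    [AddCommGroup X] [Module R X] {N : Submodule R X} (hN : N.IsBurch) :
    ∃ a ∈ maximalIdeal R, ∃ x ∈ N.colonBy (maximalIdeal R), a • x ∉ maximalIdeal R • N := by
  by_contra! h
  exact hN (le_antisymm (Submodule.smul_le.2 h)
    (Submodule.smul_mono le_rfl fun x hx r _ ↦ N.smul_mem r hx))

/-- Let `N` be a Burch submodule of `X`, and suppose that `K → F` and `ker q → G` stay injective
after tensoring with `X ⧸ N`, where `q : G → K` is surjective. If `K` lands in `𝔪 F`, then no
functional on `G` taking the value `1` maps `ker q` into `𝔪`. -/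
theorem Submodule.IsBurch.false_of_rTensor_injective {R X : Type u} [CommRing R] [IsLocalRing R]
    [AddCommGroup X] [Module R X] {N : Submodule R X} (hN : N.IsBurch)
    {K F G : Type*} [AddCommGroup K] [Module R K] [AddCommGroup F] [Module R F]
    [AddCommGroup G] [Module R G] (q : G →ₗ[R] K) (hq : Function.Surjective q) (i : K →ₗ[R] F)
    (hi : ∀ k, i k ∈ maximalIdeal R • (⊤ : Submodule R F))
    (hiY : Function.Injective (i.rTensor (X ⧸ N)))
    (hqY : Function.Injective ((LinearMap.ker q).subtype.rTensor (X ⧸ N)))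
    (p : G →ₗ[R] R) (hp : ∀ g, q g = 0 → p g ∈ maximalIdeal R) (e : G) (he : p e = 1) : False := by
  obtain ⟨a, ha, x, hx, hax⟩ := hN.exists_smul_notMem
  have hF : ∀ f ∈ maximalIdeal R • (⊤ : Submodule R F), f ⊗ₜ[R] N.mkQ x = 0 := by
    intro f hf
    induction hf using Submodule.smul_induction_on' with
    | smul r hr f _ =>
      rw [smul_tmul, ← map_smul, Submodule.mkQ_apply, (Submodule.Quotient.mk_eq_zero N).2 (hx r hr),
        tmul_zero]
    | add f _ g _ hf hg => rw [add_tmul, hf, hg, add_zero]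
  have hK : q.rTensor (X ⧸ N) (e ⊗ₜ N.mkQ x) = 0 := by
    apply hiY
    rw [LinearMap.rTensor_tmul, LinearMap.rTensor_tmul, hF _ (hi _), map_zero]
  obtain ⟨y, hy⟩ := (rTensor_exact (X ⧸ N) (LinearMap.exact_subtype_ker_map q) hq _).1 hK
  have hay : a • y = 0 := by
    apply hqY
    rw [map_smul, hy, map_zero, ← tmul_smul, ← map_smul, Submodule.mkQ_apply,
      (Submodule.Quotient.mk_eq_zero N).2 (hx a ha), tmul_zero]
  obtain ⟨y, rfl⟩ := LinearMap.lTensor_surjective _ N.mkQ_surjective y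
  rw [← map_smul] at hay
  obtain ⟨w, hw⟩ := (lTensor_exact (LinearMap.ker q) (LinearMap.exact_subtype_mkQ N)
    N.mkQ_surjective _).1 hay
  let φ (Z : Type u) [AddCommGroup Z] [Module R Z] : LinearMap.ker q ⊗[R] Z →ₗ[R] Z :=
    TensorProduct.lid R Z ∘ₗ (p ∘ₗ (LinearMap.ker q).subtype).rTensor Z
  have hφN : ∀ w, φ X ((N.subtype).lTensor _ w) ∈ maximalIdeal R • N := by
    intro w
    induction w with
    | zero => simp
    | tmul l n => simpa [φ] using Submodule.smul_mem_smul (hp l l.2) n.2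
    | add w w' h h' => rw [map_add, map_add]; exact add_mem h h'
  have hφ : ∀ z, φ (X ⧸ N) (N.mkQ.lTensor _ z) = N.mkQ (φ X z) := by
    intro z
    induction z with
    | zero => simp
    | tmul l z => simp [φ]
    | add w w' h h' => simp only [map_add, h, h']
  have hφy : N.mkQ (φ X y) = N.mkQ x := by
    rw [← hφ]
    have := congrArg (fun z ↦ TensorProduct.lid R (X ⧸ N) (p.rTensor (X ⧸ N) z)) hy
    simpa [φ, LinearMap.rTensor_comp, he] using this
  have hsub : φ X y - x ∈ N := (Submodule.Quotient.eq N).1 hφy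
  apply hax
  have h1 := hφN w
  rw [hw, map_smul] at h1
  simpa [smul_sub] using sub_mem h1 (Submodule.smul_mem_smul ha hsub)

theorem LinearMap.rTensor_lTensor_apply {R : Type*} [CommRing R] {A B C D : Type*}
    [AddCommGroup A] [Module R A] [AddCommGroup B] [Module R B]
    [AddCommGroup C] [Module R C] [AddCommGroup D] [Module R D]
    (f : A →ₗ[R] B) (g : C →ₗ[R] D) (x : A ⊗[R] C) :
    f.rTensor D (g.lTensor A x) = g.lTensor B (f.rTensor C x) := by
  rw [← LinearMap.comp_apply, ← LinearMap.comp_apply, LinearMap.rTensor_comp_lTensor,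
    LinearMap.lTensor_comp_rTensor]

/-- Dimension shifting as a diagram chase: let `0 → K → F → M → 0` be exact with `F` flat, and let
`A₃ → A₂ → A₁ → A₀` be a complex with `A₁` flat, exact at `A₁` and exact at `A₂` after tensoring
with `M`. Then every element of `K ⊗ A₁` dying in `F ⊗ A₀` comes from `K ⊗ A₂`. -/
theorem LinearMap.exists_lTensor_eq_of_exact_lTensor {R : Type*} [CommRing R]
    {K F M A₀ A₁ A₂ A₃ : Type*}
    [AddCommGroup K] [Module R K] [AddCommGroup F] [Module R F] [Module.Flat R F]
    [AddCommGroup M] [Module R M] [AddCommGroup A₀] [Module R A₀]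
    [AddCommGroup A₁] [Module R A₁] [Module.Flat R A₁]
    [AddCommGroup A₂] [Module R A₂] [AddCommGroup A₃] [Module R A₃]
    {i : K →ₗ[R] F} {g : F →ₗ[R] M} (hi : Function.Injective i) (hig : Function.Exact i g)
    (hg : Function.Surjective g)
    {d₃ : A₃ →ₗ[R] A₂} {d₂ : A₂ →ₗ[R] A₁} {d₁ : A₁ →ₗ[R] A₀}
    (h₃₂ : d₂ ∘ₗ d₃ = 0) (h₂₁ : Function.Exact d₂ d₁)
    (hM : Function.Exact (d₃.lTensor M) (d₂.lTensor M))
    (z : K ⊗[R] A₁) (hz : i.rTensor A₀ (d₁.lTensor K z) = 0) :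
    ∃ u, d₂.lTensor K u = z := by
  rw [rTensor_lTensor_apply] at hz
  obtain ⟨w, hw⟩ := (Module.Flat.lTensor_exact F h₂₁ _).1 hz
  have hw0 : d₂.lTensor M (g.rTensor A₂ w) = 0 := by
    rw [← rTensor_lTensor_apply, hw, ← LinearMap.comp_apply, ← LinearMap.rTensor_comp,
      hig.linearMap_comp_eq_zero, LinearMap.rTensor_zero, LinearMap.zero_apply]
  obtain ⟨v, hv⟩ := (hM _).1 hw0
  obtain ⟨v, rfl⟩ := LinearMap.rTensor_surjective A₃ hg v
  rw [← rTensor_lTensor_apply] at hv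
  obtain ⟨u, hu⟩ := (rTensor_exact A₂ hig hg (w - d₃.lTensor F v)).1 (by rw [map_sub, hv, sub_self])
  refine ⟨u, Module.Flat.rTensor_preserves_injective_linearMap i hi ?_⟩
  rw [rTensor_lTensor_apply, hu, map_sub, hw, ← LinearMap.comp_apply, ← LinearMap.lTensor_comp, h₃₂,
    LinearMap.lTensor_zero, LinearMap.zero_apply, sub_zero]

namespace CategoryTheory

variable {C : Type*} [Category* C] [Abelian C]

/-- A chain complex of projective objects which is exact in positive degrees, together with a
cokernel of its last differential, is a projective resolution. -/
noncomputable def ProjectiveResolution.ofExact {Z : C} (K : ChainComplex C ℕ)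
    (hK : ∀ n, Projective (K.X n)) (ε : K.X 0 ⟶ Z) (w : K.d 1 0 ≫ ε = 0)
    (hw : (ShortComplex.mk _ _ w).Exact) (hε : Epi ε)
    (h : ∀ n, (ShortComplex.mk _ _ (K.d_comp_d (n + 2) (n + 1) n)).Exact) :
    ProjectiveResolution Z where
  complex := K
  projective := hK
  π := (ChainComplex.toSingle₀Equiv _ _).symm ⟨ε, w⟩
  quasiIso := ⟨fun n ↦ by
    cases n with
    | zero =>
      rw [ChainComplex.quasiIsoAt₀_iff, ShortComplex.quasiIso_iff_of_zeros' _
        (K.shape _ _ (by simp)) rfl rfl]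
      refine (ShortComplex.exact_and_epi_g_iff_of_iso ?_).2 ⟨hw, hε⟩
      refine ShortComplex.isoMk (Iso.refl _) (Iso.refl _) (Iso.refl _) ?_ ?_
      · exact (Category.id_comp _).trans (Category.comp_id _).symm
      · exact (Category.id_comp _).trans
          ((ChainComplex.toSingle₀Equiv_symm_apply_f_zero _ _).symm.trans (Category.comp_id _).symm)
    | succ n =>
      rw [quasiIsoAt_iff_exactAt' _ _ (ChainComplex.exactAt_succ_single_obj _ _),
        HomologicalComplex.exactAt_iff' _ (n + 2) (n + 1) n (by simp) (by simp)]
      exact h n⟩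

theorem ProjectiveResolution.exists_augmentation {Z : C} (P : ProjectiveResolution Z) :
    ∃ (ε : P.complex.X 0 ⟶ Z) (w : P.complex.d 1 0 ≫ ε = 0),
      Epi ε ∧ (ShortComplex.mk _ _ w).Exact :=
  ⟨P.π.f 0, P.complex_d_comp_π_f_zero, inferInstanceAs (Epi (P.π.f 0)),
    ShortComplex.exact_of_g_is_cokernel
      (.mk (P.complex.d 1 0) (P.π.f 0) P.complex_d_comp_π_f_zero) P.isColimitCokernelCofork⟩

/-- Splicing a projective resolution of `X₁` with a short exact sequence `0 → X₁ → X₂ → X₃ → 0`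
with `X₂` projective gives a projective resolution of `X₃`. -/
theorem ShortComplex.ShortExact.exists_projectiveResolution {S : ShortComplex C}
    (hS : S.ShortExact) [Projective S.X₂] (P : ProjectiveResolution S.X₁) :
    ∃ Q : ProjectiveResolution S.X₃, ∀ n, Q.complex.X (n + 1) = P.complex.X n := by
  obtain ⟨ε, w, hε, hex⟩ := P.exists_augmentation
  have := hS.mono_f
  have wS : (ε ≫ S.f) ≫ S.g = 0 := by simp
  let α : ShortComplex.mk _ _ wS ⟶ S :=
    { τ₁ := ε, τ₂ := 𝟙 _, τ₃ := 𝟙 _ }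
  let β : ShortComplex.mk (P.complex.d 1 0) ε w ⟶
      ShortComplex.mk (P.complex.d 1 0) (ε ≫ S.f) (by rw [← Category.assoc, w, Limits.zero_comp]) :=
    { τ₁ := 𝟙 _, τ₂ := 𝟙 _, τ₃ := S.f }
  refine ⟨.ofExact (P.complex.augment (ε ≫ S.f) (by rw [← Category.assoc, w, Limits.zero_comp]))
    (fun n ↦ ?_) S.g ?_ ?_ hS.epi_g (fun n ↦ ?_), fun _ ↦ rfl⟩
  · cases n with
    | zero => assumption
    | succ n => exact P.projective n
  · exact wS
  · exact (ShortComplex.exact_iff_of_epi_of_isIso_of_mono α).2 hS.exact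
  · cases n with
    | zero => exact (ShortComplex.exact_iff_of_epi_of_isIso_of_mono β).1 hex
    | succ n => exact P.exact_succ n

end CategoryTheory

theorem HasProjDimLT.succ_of_exact {R K F M : Type u} [CommRing R] [AddCommGroup K] [Module R K]
    [AddCommGroup F] [Module R F] [Module.Projective R F] [AddCommGroup M] [Module R M]
    {i : K →ₗ[R] F} {g : F →ₗ[R] M} (hi : Function.Injective i) (hig : Function.Exact i g)
    (hg : Function.Surjective g) {t : ℕ} (hK : HasProjDimLT R K t) : HasProjDimLT R M (t + 1) := by
  obtain ⟨P, hP⟩ := hK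
  let S : ShortComplex (ModuleCat.{u} R) := .mk (ModuleCat.ofHom i) (ModuleCat.ofHom g)
    (ModuleCat.hom_ext hig.linearMap_comp_eq_zero)
  have hS : S.ShortExact :=
    { exact := (ShortComplex.ShortExact.moduleCat_exact_iff_function_exact _).2 hig
      mono_f := (ModuleCat.mono_iff_injective _).2 hi
      epi_g := (ModuleCat.epi_iff_surjective _).2 hg }
  have : Projective S.X₂ := (IsProjective.iff_projective F).1 inferInstance
  obtain ⟨Q, hQ⟩ := hS.exists_projectiveResolution P
  refine ⟨Q, fun n hn ↦ ?_⟩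
  obtain ⟨n, rfl⟩ := Nat.exists_eq_add_of_le' (Nat.one_le_of_lt hn)
  rw [hQ]
  exact hP n (by omega)

theorem HasProjDimLT.of_projective (R M : Type u) [CommRing R] [AddCommGroup M] [Module R M]
    [Module.Projective R M] : HasProjDimLT R M 1 := by
  have : Projective (ModuleCat.of R M) := (IsProjective.iff_projective M).1 inferInstance
  exact ⟨.self _, fun i hi ↦ HomologicalComplex.isZero_single_obj_X _ _ _ _ (by omega)⟩

/-- `Tor_{n+1}(M, Y) = 0` is exactness of `M ⊗ P` in degree `n + 1` for any projective resolution
`P` of `Y`. -/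
theorem torIsZero_succ_iff {R M Y : Type u} [CommRing R] [AddCommGroup M] [Module R M]
    [AddCommGroup Y] [Module R Y] (P : ProjectiveResolution (ModuleCat.of R Y)) (n : ℕ) :
    TorIsZero R M Y (n + 1) ↔ Function.Exact ((P.complex.d (n + 2) (n + 1)).hom.lTensor M)
      ((P.complex.d (n + 1) n).hom.lTensor M) := by
  let T := (MonoidalCategory.tensoringLeft (ModuleCat.{u} R)).obj (ModuleCat.of R M)
  rw [TorIsZero, ← ModuleCat.isZero_iff_subsingleton]
  refine (P.isoLeftDerivedObj T (n + 1)).isZero_iff.trans ?_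
  refine (HomologicalComplex.exactAt_iff_isZero_homology _ _).symm.trans ?_
  rw [HomologicalComplex.exactAt_iff' _ (n + 2) (n + 1) n (by simp) (by simp)]
  exact ShortComplex.ShortExact.moduleCat_exact_iff_function_exact _

section

variable {R Y : Type u} [CommRing R] [AddCommGroup Y] [Module R Y]
  {K F M : Type u} [AddCommGroup K] [Module R K] [AddCommGroup F] [Module R F] [Module.Flat R F]
  [AddCommGroup M] [Module R M] {i : K →ₗ[R] F} {g : F →ₗ[R] M}

theorem TorIsZero.of_exact (hi : Function.Injective i) (hig : Function.Exact i g)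
    (hg : Function.Surjective g) {n : ℕ} (h : TorIsZero R M Y (n + 2)) :
    TorIsZero R K Y (n + 1) := by
  let P := projectiveResolution (ModuleCat.of R Y)
  have : Module.Flat R (P.complex.X (n + 1)) :=
    have := (IsProjective.iff_projective (R := R) (P.complex.X (n + 1))).2 (P.projective _)
    inferInstance
  rw [torIsZero_succ_iff P] at h ⊢
  have hP := fun n ↦ (ShortComplex.ShortExact.moduleCat_exact_iff_function_exact _).1
    (P.exact_succ n)
  refine fun z ↦ ⟨fun hz ↦ ?_, ?_⟩
  · exact LinearMap.exists_lTensor_eq_of_exact_lTensor hi hig hg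
      (hP (n + 1)).linearMap_comp_eq_zero (hP n) h z (by rw [hz, map_zero])
  · rintro ⟨u, rfl⟩
    rw [← LinearMap.comp_apply, ← LinearMap.lTensor_comp, (hP n).linearMap_comp_eq_zero,
      LinearMap.lTensor_zero, LinearMap.zero_apply]

theorem TorIsZero.rTensor_injective (hi : Function.Injective i) (hig : Function.Exact i g)
    (hg : Function.Surjective g) (h : TorIsZero R M Y 1) :
    Function.Injective (i.rTensor Y) := by
  let P := projectiveResolution (ModuleCat.of R Y)
  have : Module.Flat R (P.complex.X 0) :=
    have := (IsProjective.iff_projective (R := R) (P.complex.X 0)).2 (P.projective _)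
    inferInstance
  rw [torIsZero_succ_iff P] at h
  obtain ⟨ε, w, hε, hex⟩ := P.exists_augmentation
  replace hε : Function.Surjective ε.hom := (ModuleCat.epi_iff_surjective ε).1 hε
  replace hex : Function.Exact (P.complex.d 1 0).hom ε.hom :=
    (ShortComplex.ShortExact.moduleCat_exact_iff_function_exact _).1 hex
  have hd := (ShortComplex.ShortExact.moduleCat_exact_iff_function_exact _).1 (P.exact_succ 0)
  rw [injective_iff_map_eq_zero]
  intro y hy
  obtain ⟨z, rfl⟩ := LinearMap.lTensor_surjective K hε y
  obtain ⟨u, rfl⟩ := LinearMap.exists_lTensor_eq_of_exact_lTensor hi hig hg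
    hd.linearMap_comp_eq_zero hex h z hy
  rw [← LinearMap.comp_apply, ← LinearMap.lTensor_comp, hex.linearMap_comp_eq_zero,
    LinearMap.lTensor_zero, LinearMap.zero_apply]

end

theorem IsLocalRing.mem_maximalIdeal_smul_top_pi {R : Type*} [CommRing R] [IsLocalRing R] {n : ℕ}
    {c : Fin n → R} (hc : ∀ j, c j ∈ maximalIdeal R) :
    c ∈ maximalIdeal R • (⊤ : Submodule R (Fin n → R)) := by
  rw [pi_eq_sum_univ' c]
  exact sum_mem fun j _ ↦ Submodule.smul_mem_smul (hc j) trivial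

/-- Over a Noetherian local ring, if `N` is a Burch submodule of a finitely
generated module `X`, `M` is finitely generated, `t ≥ 1`, and
`Tor_t^R(M, X/N) = Tor_{t+1}^R(M, X/N) = 0`, then `pd_R M < t`. -/
theorem burch_quotient_two_consecutive_tor_vanishing
    {R : Type u} [CommRing R] [IsNoetherianRing R] [IsLocalRing R]
    {X : Type u} [AddCommGroup X] [Module R X] [Module.Finite R X]
    (N : Submodule R X) (hN : N.IsBurch)
    {M : Type u} [AddCommGroup M] [Module R M] [Module.Finite R M]
    (t : ℕ) (ht : 1 ≤ t)
    (h1 : TorIsZero R M (X ⧸ N) t) (h2 : TorIsZero R M (X ⧸ N) (t + 1)) :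
    HasProjDimLT R M t := by
  obtain ⟨t, rfl⟩ := Nat.exists_eq_add_of_le' ht
  clear ht
  induction t generalizing M with
  | zero =>
    obtain ⟨n, f, hf, hfm⟩ := exists_minimal_free_cover R M
    have hfe := LinearMap.exact_subtype_ker_map f
    have hfi := (LinearMap.ker f).injective_subtype
    obtain ⟨m, q, hq, hqm⟩ := exists_minimal_free_cover R (LinearMap.ker f)
    have hqe := LinearMap.exact_subtype_ker_map q
    obtain _ | m := m
    · have hker : LinearMap.ker f = ⊥ :=
        (Submodule.subsingleton_iff_eq_bot).1 hq.subsingleton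
      have := Module.Projective.of_equiv
        (LinearEquiv.ofBijective f ⟨LinearMap.ker_eq_bot.1 hker, hf⟩)
      exact .of_projective R M
    · exact (hN.false_of_rTensor_injective q hq (LinearMap.ker f).subtype
        (fun k ↦ mem_maximalIdeal_smul_top_pi (hfm k k.2)) (h1.rTensor_injective hfi hfe hf)
        ((h2.of_exact hfi hfe hf).rTensor_injective (LinearMap.ker q).injective_subtype hqe hq)
        (LinearMap.proj 0) (fun c hc ↦ hqm c hc 0) (Pi.single 0 1) (by simp)).elim
  | succ t ih =>
    obtain ⟨n, f, hf, -⟩ := exists_minimal_free_cover R M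
    have hfe := LinearMap.exact_subtype_ker_map f
    have hfi := (LinearMap.ker f).injective_subtype
    exact .succ_of_exact hfi hfe hf (ih (h1.of_exact hfi hfe hf) (h2.of_exact hfi hfe hf))
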